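/- arXiv:1706.10179 — 8 statements merged into one kernel-verified Lean document; each statement's English description precedes it below -/
import Mathlib

section
/- Let τ > 0 and θ ∈ ℝ with θ ≠ 0. Then ∫_{-∞}^{∞} (|t|/(√(2π)·τ))·exp(−θ²t²/(2τ²)) · [∫_{1}^{∞} (1/√(2πs))·exp(−t²/(2s))·(1/2)·s^{−3/2} ds] dt = (1/(2πτ))·log(1 + τ²/θ²). In other words, the horseshoe-like prior density p̃(θ | τ²) = (1/(2πτ))·log(1 + τ²/θ²) admits the global-local Gaussian scale mixture representation θ | t, τ ~ N(0, τ²/t²), t | s ~ N(0, s), s ~ Pareto(1/2) (i.e., s has density (1/2)s^{−3/2} on s ≥ 1). -/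
open MeasureTheory Real

/-- Frullani's integral for the Gaussian: the case `f x = exp (-x ^ 2)`, at `√a` and `√b`. -/
theorem integral_Ioi_inv_mul_exp_neg_mul_sq_sub {a b : ℝ} (ha : 0 < a) (hab : a ≤ b) :
    ∫ x in Set.Ioi (0 : ℝ), x⁻¹ * (exp (-a * x ^ 2) - exp (-b * x ^ 2)) = log (b / a) / 2 := by
  have hb : 0 < b := ha.trans_le hab
  have hcont : Continuous fun x : ℝ => exp (-x ^ 2) := by fun_prop
  have hscale {c : ℝ} (hc : 0 < c) (x : ℝ) : -(√c * x) ^ 2 = -c * x ^ 2 := by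
    rw [mul_pow, sq_sqrt hc.le, neg_mul]
  have hint : IntegrableOn (fun x : ℝ => x⁻¹ * (exp (-a * x ^ 2) - exp (-b * x ^ 2)))
      (Set.Ioi 0) := by
    refine (((integrable_mul_exp_neg_mul_sq ha).const_mul (b - a)).integrableOn).mono'
      (by fun_prop) ?_
    refine (ae_restrict_mem measurableSet_Ioi).mono fun x (hx : 0 < x) => ?_
    have hle : exp (-b * x ^ 2) ≤ exp (-a * x ^ 2) := by gcongr
    have hfac : exp (-b * x ^ 2) = exp (-a * x ^ 2) * exp (-((b - a) * x ^ 2)) := by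
      rw [← exp_add]; ring_nf
    have hlin := one_sub_le_exp_neg ((b - a) * x ^ 2)
    rw [norm_of_nonneg (mul_nonneg (inv_nonneg.2 hx.le) (sub_nonneg.2 hle)),
      inv_mul_le_iff₀ hx, hfac]
    nlinarith [exp_pos (-a * x ^ 2)]
  have hL : Filter.Tendsto (fun x : ℝ => exp (-x ^ 2)) (nhdsWithin 0 (Set.Ioi 0)) (nhds 1) := by
    simpa using (hcont.tendsto 0).mono_left nhdsWithin_le_nhds
  have hR : Filter.Tendsto (fun x : ℝ => exp (-x ^ 2)) Filter.atTop (nhds 0) :=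
    tendsto_exp_neg_atTop_nhds_zero.comp (Filter.tendsto_pow_atTop two_ne_zero)
  have key := Frullani.integral_Ioi_eq (hcont.locallyIntegrable.locallyIntegrableOn _)
    (sqrt_pos.2 ha) (sqrt_pos.2 hb) hL hR (by simpa only [hscale ha, hscale hb, smul_eq_mul])
  simp only [hscale ha, hscale hb, smul_eq_mul, sub_zero, mul_one] at key
  rw [key, ← sqrt_div hb.le, log_sqrt (div_pos hb ha).le]

theorem integral_Ioi_one_exp_neg_div_div_sq {c : ℝ} (hc : 0 < c) :
    ∫ s in Set.Ioi (1 : ℝ), exp (-c / s) / s ^ 2 = (1 - exp (-c)) / c := by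
  have hderiv (s : ℝ) (hs : s ∈ Set.Ici (1 : ℝ)) :
      HasDerivAt (fun s => exp (-c / s) / c) (exp (-c / s) / s ^ 2) s := by
    have hs0 : s ≠ 0 := (zero_lt_one.trans_le hs).ne'
    convert! (((hasDerivAt_const s (-c)).div (hasDerivAt_id s) hs0).exp.div_const c) using 1
    simp only [id, Pi.div_apply]
    field_simp
    ring
  have hlim : Filter.Tendsto (fun s : ℝ => exp (-c / s) / c) Filter.atTop (nhds (1 / c)) := by
    simpa using
      ((continuous_exp.tendsto 0).comp (tendsto_const_nhds.div_atTop Filter.tendsto_id)).div_const c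
  rw [integral_Ioi_of_hasDerivAt_of_nonneg' hderiv (fun s _ => by positivity) hlim, div_one,
    sub_div]

/-- The marginal density of `t` when `t | s ~ N(0, s)` and `s ~ Pareto(1/2)`. -/
theorem integral_gaussian_mul_pareto {t : ℝ} (ht : t ≠ 0) :
    (∫ s in Set.Ici (1 : ℝ),
      (1 / √(2 * π * s)) * exp (-(t ^ 2) / (2 * s)) * (1 / 2) * s ^ (-(3 : ℝ) / 2))
      = (1 - exp (-(t ^ 2 / 2))) / (√(2 * π) * t ^ 2) := by
  have hintegrand (s : ℝ) (hs : s ∈ Set.Ioi (1 : ℝ)) :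
      (1 / √(2 * π * s)) * exp (-(t ^ 2) / (2 * s)) * (1 / 2) * s ^ (-(3 : ℝ) / 2)
        = 1 / (2 * √(2 * π)) * (exp (-(t ^ 2 / 2) / s) / s ^ 2) := by
    have hs0 : 0 < s := zero_lt_one.trans hs
    have hpow : s ^ (-(3 : ℝ) / 2) = √s / s ^ 2 := by
      rw [sqrt_eq_rpow, ← rpow_natCast s 2, ← rpow_sub hs0]
      norm_num
    have hexp : -(t ^ 2) / (2 * s) = -(t ^ 2 / 2) / s := by field_simp
    rw [hpow, hexp, sqrt_mul (by positivity)]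
    field_simp
  rw [integral_Ici_eq_integral_Ioi, setIntegral_congr_fun measurableSet_Ioi hintegrand,
    integral_const_mul, integral_Ioi_one_exp_neg_div_div_sq (by positivity)]
  field_simp

/-- The horseshoe-like prior density `(1/(2πτ))·log(1 + τ²/θ²)` arises as the
global-local Gaussian scale mixture `θ | t ~ N(0, τ²/t²)`, `t | s ~ N(0, s)`,
`s ~ Pareto(1/2)` (density `(1/2)·s^{-3/2}` on `s ≥ 1`). -/
theorem horseshoe_like_scale_mixture (τ θ : ℝ) (hτ : 0 < τ) (hθ : θ ≠ 0) :
    (∫ t : ℝ,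
      (|t| / (Real.sqrt (2 * π) * τ)) * Real.exp (-(θ ^ 2 * t ^ 2) / (2 * τ ^ 2)) *
        ∫ s in Set.Ici (1 : ℝ),
          (1 / Real.sqrt (2 * π * s)) * Real.exp (-(t ^ 2) / (2 * s)) * (1 / 2) *
            s ^ (-(3 : ℝ) / 2))
      = (1 / (2 * π * τ)) * Real.log (1 + τ ^ 2 / θ ^ 2) := by
  have hintegrand (t : ℝ) :
      (|t| / (√(2 * π) * τ)) * exp (-(θ ^ 2 * t ^ 2) / (2 * τ ^ 2)) *
        (∫ s in Set.Ici (1 : ℝ),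
          (1 / √(2 * π * s)) * exp (-(t ^ 2) / (2 * s)) * (1 / 2) * s ^ (-(3 : ℝ) / 2))
      = 1 / (2 * π * τ) * (|t|⁻¹ * (exp (-(θ ^ 2 / (2 * τ ^ 2)) * |t| ^ 2)
          - exp (-(θ ^ 2 / (2 * τ ^ 2) + 1 / 2) * |t| ^ 2))) := by
    rcases eq_or_ne t 0 with rfl | ht
    · simp
    have hfac : exp (-(θ ^ 2 / (2 * τ ^ 2) + 1 / 2) * t ^ 2)
        = exp (-(θ ^ 2 / (2 * τ ^ 2)) * t ^ 2) * exp (-(t ^ 2 / 2)) := by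
      rw [← exp_add]; ring_nf
    have hexp : -(θ ^ 2 * t ^ 2) / (2 * τ ^ 2) = -(θ ^ 2 / (2 * τ ^ 2)) * t ^ 2 := by ring
    have hπ : √(2 * π) ^ 2 = 2 * π := sq_sqrt (by positivity)
    have ht' : 0 < |t| := abs_pos.2 ht
    rw [integral_gaussian_mul_pareto ht, hexp, sq_abs, hfac, ← sq_abs t]
    field_simp
    rw [hπ]
  have hratio : (θ ^ 2 / (2 * τ ^ 2) + 1 / 2) / (θ ^ 2 / (2 * τ ^ 2)) = 1 + τ ^ 2 / θ ^ 2 := by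
    field_simp
  simp_rw [hintegrand]
  rw [integral_const_mul, integral_comp_abs (f := fun x : ℝ =>
      x⁻¹ * (exp (-(θ ^ 2 / (2 * τ ^ 2)) * x ^ 2)
        - exp (-(θ ^ 2 / (2 * τ ^ 2) + 1 / 2) * x ^ 2))),
    integral_Ioi_inv_mul_exp_neg_mul_sq_sub (by positivity) (by linarith), hratio]
  ring
end

section
/- For every t ∈ ℝ with t ≠ 0, ∫_{1}^{∞} (1/√(2πs))·exp(−t²/(2s))·(1/2)·s^{−3/2} ds = (φ(0) − φ(t))/t² = (1/√(2π))·(1 − exp(−t²/2))/t². That is, a normal scale mixture with N(0, s) kernel and Pareto(1/2) mixing density yields the slash-normal density. -/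
open MeasureTheory Real

/-- The standard normal density. -/
noncomputable def stdNormalPDF (x : ℝ) : ℝ :=
  (1 / Real.sqrt (2 * π)) * Real.exp (-(x ^ 2) / 2)

open Filter Topology

/-- For `s > 0` the square root in the normal kernel and the Pareto density combine to `s⁻²`. -/
lemma normal_kernel_mul_pareto_eq (t : ℝ) {s : ℝ} (hs : 0 < s) :
    (1 / Real.sqrt (2 * π * s)) * Real.exp (-(t ^ 2) / (2 * s)) * (1 / 2) * s ^ (-(3 : ℝ) / 2)
      = (1 / Real.sqrt (2 * π)) * Real.exp (-(t ^ 2) / (2 * s)) / (2 * s ^ 2) := by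
  have hpow : s ^ (-(3 : ℝ) / 2) = Real.sqrt s / s ^ 2 := by
    rw [Real.sqrt_eq_rpow, ← Real.rpow_natCast s 2, ← Real.rpow_sub hs]
    norm_num
  have hsqrt : Real.sqrt s ≠ 0 := (Real.sqrt_pos.2 hs).ne'
  have hpi : Real.sqrt (2 * π) ≠ 0 := (Real.sqrt_pos.2 (by positivity)).ne'
  rw [hpow, Real.sqrt_mul (by positivity)]
  field_simp

lemma hasDerivAt_exp_neg_sq_div {t s : ℝ} (ht : t ≠ 0) (hs : s ≠ 0) :
    HasDerivAt (fun s => (1 / Real.sqrt (2 * π)) * Real.exp (-(t ^ 2) / (2 * s)) / t ^ 2)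
      ((1 / Real.sqrt (2 * π)) * Real.exp (-(t ^ 2) / (2 * s)) / (2 * s ^ 2)) s := by
  have hinner : HasDerivAt (fun s : ℝ => -(t ^ 2) / (2 * s)) (t ^ 2 / (2 * s ^ 2)) s := by
    refine ((hasDerivAt_const s (-(t ^ 2))).div ((hasDerivAt_id s).const_mul 2)
      (mul_ne_zero two_ne_zero hs)).congr_deriv ?_
    simp only [id]
    field_simp
    ring
  refine ((hinner.exp.const_mul (1 / Real.sqrt (2 * π))).div_const (t ^ 2)).congr_deriv ?_
  field_simp

/-- A normal scale mixture with `N(0, s)` kernel and `Pareto(1/2)` mixing density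
yields the slash-normal density `(φ(0) − φ(t))/t²`. -/
theorem slash_normal_mixture (t : ℝ) (ht : t ≠ 0) :
    (∫ s in Set.Ici (1 : ℝ),
        (1 / Real.sqrt (2 * π * s)) * Real.exp (-(t ^ 2) / (2 * s)) * (1 / 2) *
          s ^ (-(3 : ℝ) / 2))
      = (stdNormalPDF 0 - stdNormalPDF t) / t ^ 2 ∧
    (stdNormalPDF 0 - stdNormalPDF t) / t ^ 2
      = (1 / Real.sqrt (2 * π)) * (1 - Real.exp (-(t ^ 2) / 2)) / t ^ 2 := by
  have hslash : (stdNormalPDF 0 - stdNormalPDF t) / t ^ 2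
      = (1 / Real.sqrt (2 * π)) * (1 - Real.exp (-(t ^ 2) / 2)) / t ^ 2 := by
    simp [stdNormalPDF, mul_sub]
  refine ⟨?_, hslash⟩
  have hlim : Tendsto (fun s : ℝ => (1 / Real.sqrt (2 * π)) * Real.exp (-(t ^ 2) / (2 * s)) / t ^ 2)
      atTop (𝓝 ((1 / Real.sqrt (2 * π)) * Real.exp 0 / t ^ 2)) :=
    (((Real.continuous_exp.tendsto 0).comp
      ((tendsto_id.const_mul_atTop two_pos).const_div_atTop _)).const_mul _).div_const _
  rw [hslash, integral_Ici_eq_integral_Ioi,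
    setIntegral_congr_fun measurableSet_Ioi
      fun s hs => normal_kernel_mul_pareto_eq t (zero_lt_one.trans hs),
    integral_Ioi_of_hasDerivAt_of_nonneg'
      (fun s hs => hasDerivAt_exp_neg_sq_div ht (zero_lt_one.trans_le hs).ne')
      (fun s _ => by positivity) hlim]
  rw [Real.exp_zero, mul_one 2]
  ring
end

section
/- Let τ > 0 and let p̃(θ | τ²) = (1/(2πτ))·log(1 + τ²/θ²) be the horseshoe-like density. Then (i) lim_{θ → 0⁺} p̃(θ | τ²) / ((1/(πτ))·log(τ/θ)) = 1, so the density has an infinite spike of logarithmic order at the origin, and (ii) lim_{θ → ∞} θ²·p̃(θ | τ²) = τ/(2π), so the density has polynomial tails of order θ^{−2}. -/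
open MeasureTheory Real Filter Topology

/-- The logarithm of `1 + τ²/θ²` splits into its singular and regular parts at the origin. -/
lemma log_one_add_sq_div_sq {τ θ : ℝ} (hτ : 0 < τ) (hθ : 0 < θ) :
    Real.log (1 + τ ^ 2 / θ ^ 2) = 2 * Real.log (τ / θ) + Real.log (1 + θ ^ 2 / τ ^ 2) := by
  have h : 1 + τ ^ 2 / θ ^ 2 = (τ / θ) ^ 2 * (1 + θ ^ 2 / τ ^ 2) := by
    field_simp
    ring
  rw [h, Real.log_mul (by positivity) (by positivity), Real.log_pow]
  norm_num

/-- The horseshoe-like density `p̃(θ|τ²) = (1/(2πτ))·log(1 + τ²/θ²)` has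
(i) an infinite spike of logarithmic order at the origin:
`p̃(θ|τ²) / ((1/(πτ))·log(τ/θ)) → 1` as `θ → 0⁺`, and
(ii) polynomial tails of order `θ^{-2}`: `θ²·p̃(θ|τ²) → τ/(2π)` as `θ → ∞`. -/
theorem horseshoe_like_origin_and_tails (τ : ℝ) (hτ : 0 < τ) :
    Tendsto
      (fun θ : ℝ =>
        ((1 / (2 * π * τ)) * Real.log (1 + τ ^ 2 / θ ^ 2)) /
          ((1 / (π * τ)) * Real.log (τ / θ)))
      (nhdsWithin 0 (Set.Ioi 0)) (nhds 1) ∧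
    Tendsto
      (fun θ : ℝ => θ ^ 2 * ((1 / (2 * π * τ)) * Real.log (1 + τ ^ 2 / θ ^ 2)))
      atTop (nhds (τ / (2 * π))) := by
  constructor
  · have hlog : Tendsto (fun θ : ℝ => Real.log (τ / θ)) (𝓝[>] 0) atTop :=
      Real.tendsto_log_atTop.comp (tendsto_inv_nhdsGT_zero.const_mul_atTop hτ)
    have hreg : Tendsto (fun θ : ℝ => Real.log (1 + θ ^ 2 / τ ^ 2)) (𝓝[>] 0) (𝓝 0) := by
      have hc : ContinuousAt (fun θ : ℝ => Real.log (1 + θ ^ 2 / τ ^ 2)) 0 :=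
        ContinuousAt.log (by fun_prop) (by simp)
      simpa using hc.tendsto.mono_left nhdsWithin_le_nhds
    have hlim := ((hreg.div_atTop hlog).div_const 2).const_add 1
    rw [zero_div, add_zero] at hlim
    refine hlim.congr' ?_
    filter_upwards [hlog.eventually_gt_atTop 0, self_mem_nhdsWithin] with θ hpos hθ
    rw [log_one_add_sq_div_sq hτ hθ]
    generalize Real.log (τ / θ) = L at hpos ⊢
    field_simp
  · have hlim := ((tendsto_mul_log_one_add_div_atTop (τ ^ 2)).comp
      (tendsto_pow_atTop (α := ℝ) two_ne_zero)).const_mul (1 / (2 * π * τ))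
    have hval : 1 / (2 * π * τ) * τ ^ 2 = τ / (2 * π) := by
      field_simp
    rw [hval] at hlim
    exact hlim.congr fun θ => mul_left_comm _ _ _
end

section
/- Let τ > 0 and let λ be a standard half-Cauchy random variable with density 2/(π(1 + λ²)) on (0, ∞), as in the horseshoe prior. Then the shrinkage weight κ = 1/(1 + λ²τ²) has density f(κ) = τ / (π·√(κ(1−κ))·(1 + κ(τ² − 1))) on (0, 1). In particular, when τ = 1, κ follows the Beta(1/2, 1/2) distribution with density 1/(π·√(κ(1−κ))), whose horseshoe shape gives the prior its name. -/
open MeasureTheory Real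

/-- The map `l ↦ 1 / (1 + l²τ²)` restricts to an injection on the positive reals. -/
lemma injOn_shrinkageWeight {τ : ℝ} (hτ : 0 < τ) :
    Set.InjOn (fun l : ℝ => 1 / (1 + l ^ 2 * τ ^ 2)) (Set.Ioi 0) := by
  intro a ha b hb hab
  have h : a ^ 2 * τ ^ 2 = b ^ 2 * τ ^ 2 := by
    simpa using hab
  have hsq : a ^ 2 = b ^ 2 := mul_right_cancel₀ (by positivity) h
  exact (pow_left_inj₀ (le_of_lt ha) (le_of_lt hb) two_ne_zero).1 hsq

/-- The map `l ↦ 1 / (1 + l²τ²)` sends the positive reals onto `(0, 1)`. -/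
lemma image_shrinkageWeight_Ioi {τ : ℝ} (hτ : 0 < τ) :
    (fun l : ℝ => 1 / (1 + l ^ 2 * τ ^ 2)) '' Set.Ioi 0 = Set.Ioo 0 1 := by
  ext k
  constructor
  · rintro ⟨l, hl, rfl⟩
    have hl : 0 < l := hl
    have h : 0 < l ^ 2 * τ ^ 2 := by positivity
    exact ⟨by positivity, (div_lt_one (by positivity)).2 (by linarith)⟩
  · rintro ⟨h0, h1⟩
    have h : 0 < (1 - k) / k := div_pos (sub_pos.2 h1) h0
    refine ⟨√((1 - k) / k) / τ, div_pos (Real.sqrt_pos.2 h) hτ, ?_⟩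
    simp only [div_pow, Real.sq_sqrt h.le]
    field_simp
    ring

lemma hasDerivAt_shrinkageWeight (τ l : ℝ) :
    HasDerivAt (fun l : ℝ => 1 / (1 + l ^ 2 * τ ^ 2))
      (-(2 * l * τ ^ 2) / (1 + l ^ 2 * τ ^ 2) ^ 2) l := by
  have h : HasDerivAt (fun l : ℝ => 1 + l ^ 2 * τ ^ 2) (2 * l * τ ^ 2) l := by
    simpa using ((hasDerivAt_pow 2 l).mul_const (τ ^ 2)).const_add 1
  simpa only [one_div] using h.fun_inv (by positivity)

/-- The Jacobian identity relating the half-Cauchy density to the density of the shrinkage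
weight. -/
lemma abs_deriv_mul_shrinkageWeight_density {τ l : ℝ} (hτ : 0 < τ) (hl : 0 < l) :
    |-(2 * l * τ ^ 2) / (1 + l ^ 2 * τ ^ 2) ^ 2| *
      (τ / (π * √(1 / (1 + l ^ 2 * τ ^ 2) * (1 - 1 / (1 + l ^ 2 * τ ^ 2))) *
        (1 + 1 / (1 + l ^ 2 * τ ^ 2) * (τ ^ 2 - 1)))) = 2 / (π * (1 + l ^ 2)) := by
  have hsqrt : √(1 / (1 + l ^ 2 * τ ^ 2) * (1 - 1 / (1 + l ^ 2 * τ ^ 2))) =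
      l * τ / (1 + l ^ 2 * τ ^ 2) := by
    rw [← Real.sqrt_sq (show 0 ≤ l * τ / (1 + l ^ 2 * τ ^ 2) by positivity)]
    congr 1
    field_simp
    ring
  have hlin : 1 + 1 / (1 + l ^ 2 * τ ^ 2) * (τ ^ 2 - 1) =
      τ ^ 2 * (1 + l ^ 2) / (1 + l ^ 2 * τ ^ 2) := by
    field_simp
    ring
  rw [hsqrt, hlin, neg_div, abs_neg, abs_of_pos (by positivity)]
  field_simp

/-- Under the horseshoe prior, if `λ ~ C⁺(0,1)` (density `2/(π(1+λ²))` on `(0,∞)`),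
then the shrinkage weight `κ = 1/(1 + λ²τ²)` has density
`τ/(π·√(κ(1−κ))·(1 + κ(τ²−1)))` on `(0,1)`. In particular, for `τ = 1` this is the
`Beta(1/2,1/2)` density `1/(π·√(κ(1−κ)))`, the "horseshoe" shape. -/
theorem horseshoe_shrinkage_weight_density (τ : ℝ) (hτ : 0 < τ) :
    (Measure.map (fun l : ℝ => 1 / (1 + l ^ 2 * τ ^ 2))
        ((volume.restrict (Set.Ioi (0 : ℝ))).withDensity
          (fun l => ENNReal.ofReal (2 / (π * (1 + l ^ 2)))))
      = (volume.restrict (Set.Ioo (0 : ℝ) 1)).withDensity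
          (fun k => ENNReal.ofReal
            (τ / (π * Real.sqrt (k * (1 - k)) * (1 + k * (τ ^ 2 - 1)))))) ∧
    (τ = 1 → ∀ k ∈ Set.Ioo (0 : ℝ) 1,
      τ / (π * Real.sqrt (k * (1 - k)) * (1 + k * (τ ^ 2 - 1)))
        = 1 / (π * Real.sqrt (k * (1 - k)))) := by
  refine ⟨?_, ?_⟩
  · have hmeas : Measurable (fun l : ℝ => 1 / (1 + l ^ 2 * τ ^ 2)) := by fun_prop
    ext A hA
    have hpre := hmeas hA
    rw [Measure.map_apply hmeas hA, withDensity_apply _ hpre, withDensity_apply _ hA,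
      Measure.restrict_restrict hpre, Measure.restrict_restrict hA,
      ← image_shrinkageWeight_Ioi hτ, ← Set.image_preimage_inter,
      lintegral_image_eq_lintegral_abs_deriv_mul (hpre.inter measurableSet_Ioi)
        (fun l _ => (hasDerivAt_shrinkageWeight τ l).hasDerivWithinAt)
        ((injOn_shrinkageWeight hτ).mono Set.inter_subset_right)]
    refine setLIntegral_congr_fun (hpre.inter measurableSet_Ioi) fun l hl => ?_
    rw [← ENNReal.ofReal_mul (abs_nonneg _), abs_deriv_mul_shrinkageWeight_density hτ hl.2]
  · rintro rfl k -
    simp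
end

section
/- Let λ₁ > 0, λ₂ > 0, σ > 0, and let p(θ | λ₁, λ₂) be the orthant-normal density: p(θ) = φ(θ | λ₁/(2λ₂), σ²/λ₂) / (2Φ(−λ₁/(2σ√λ₂))) for θ < 0 and p(θ) = φ(θ | −λ₁/(2λ₂), σ²/λ₂) / (2Φ(−λ₁/(2σ√λ₂))) for θ ≥ 0. Then for all θ ∈ ℝ, p(θ | λ₁, λ₂) = C·exp(−(λ₁|θ| + λ₂θ²)/(2σ²)), where C = √(λ₂/(2πσ²))·exp(−λ₁²/(8σ²λ₂)) / (2Φ(−λ₁/(2σ√λ₂))). In particular, the orthant-normal prior is exactly the elastic net prior, proportional to exp(−(λ₁|θ| + λ₂θ²)/(2σ²)). -/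
open MeasureTheory Real

/-- The normal density with mean `μ` and variance `v`. -/
noncomputable def normalPDF (x μ v : ℝ) : ℝ :=
  (1 / Real.sqrt (2 * π * v)) * Real.exp (-(x - μ) ^ 2 / (2 * v))

/-- The standard normal cumulative distribution function. -/
noncomputable def stdNormalCDF (x : ℝ) : ℝ :=
  ∫ t in Set.Iio x, (1 / Real.sqrt (2 * π)) * Real.exp (-(t ^ 2) / 2)

/-- The orthant-normal density with parameters `λ₁, λ₂, σ`. -/
noncomputable def orthantNormalPDF (lam₁ lam₂ σ θ : ℝ) : ℝ :=
  if θ < 0 then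
    normalPDF θ (lam₁ / (2 * lam₂)) (σ ^ 2 / lam₂) /
      (2 * stdNormalCDF (-(lam₁ / (2 * σ * Real.sqrt lam₂))))
  else
    normalPDF θ (-(lam₁ / (2 * lam₂))) (σ ^ 2 / lam₂) /
      (2 * stdNormalCDF (-(lam₁ / (2 * σ * Real.sqrt lam₂))))

/-- Completing the square in a normal density with variance `σ² / a`. -/
lemma normalPDF_eq_mul_exp (a b σ x : ℝ) (ha : 0 < a) (hσ : 0 < σ) :
    normalPDF x (b / (2 * a)) (σ ^ 2 / a) =
      Real.sqrt (a / (2 * π * σ ^ 2)) * Real.exp (-(b ^ 2) / (8 * σ ^ 2 * a)) *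
        Real.exp (-(-(b * x) + a * x ^ 2) / (2 * σ ^ 2)) := by
  rw [normalPDF, mul_assoc (√_), ← Real.exp_add, one_div, ← Real.sqrt_inv]
  congr 2
  · field_simp
  · field_simp
    ring

/-- The orthant-normal prior is exactly the elastic net prior: it equals
`C·exp(−(λ₁|θ| + λ₂θ²)/(2σ²))` with
`C = √(λ₂/(2πσ²))·exp(−λ₁²/(8σ²λ₂)) / (2Φ(−λ₁/(2σ√λ₂)))`. -/
theorem orthant_normal_is_elastic_net (lam₁ lam₂ σ : ℝ)
    (h₁ : 0 < lam₁) (h₂ : 0 < lam₂) (hσ : 0 < σ) :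
    ∀ θ : ℝ, orthantNormalPDF lam₁ lam₂ σ θ
      = (Real.sqrt (lam₂ / (2 * π * σ ^ 2)) * Real.exp (-(lam₁ ^ 2) / (8 * σ ^ 2 * lam₂)) /
          (2 * stdNormalCDF (-(lam₁ / (2 * σ * Real.sqrt lam₂))))) *
        Real.exp (-(lam₁ * |θ| + lam₂ * θ ^ 2) / (2 * σ ^ 2)) := by
  intro θ
  rw [orthantNormalPDF, div_mul_eq_mul_div]
  split_ifs with hθ
  · rw [normalPDF_eq_mul_exp lam₂ lam₁ σ θ h₂ hσ, abs_of_neg hθ, mul_neg]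
  · rw [← neg_div, normalPDF_eq_mul_exp lam₂ (-lam₁) σ θ h₂ hσ, abs_of_nonneg (not_lt.mp hθ),
      neg_sq, neg_mul, neg_neg]
end

section
/- Let n ≥ 3 and let Y ~ N(θ, I_n) for θ ∈ ℝⁿ. The James–Stein estimator θ̂_JS(y) = (1 − (n−2)/‖y‖²)·y satisfies E_{Y|θ}‖θ̂_JS(Y) − θ‖² < n = E_{Y|θ}‖Y − θ‖² for every θ ∈ ℝⁿ; that is, the James–Stein estimator uniformly dominates the maximum likelihood estimator Y in total squared-error risk. -/
open MeasureTheory ProbabilityTheory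

open Filter Topology
open scoped NNReal

lemma hasDerivAt_gaussianPDFReal (μ : ℝ) {v : ℝ≥0} (hv : v ≠ 0) (x : ℝ) :
    HasDerivAt (gaussianPDFReal μ v) (-((x - μ) / v) * gaussianPDFReal μ v x) x := by
  have hv' : (v : ℝ) ≠ 0 := by exact_mod_cast hv
  have h1 : HasDerivAt (fun x : ℝ => -(x - μ) ^ 2 / (2 * v)) (-((x - μ) / v)) x := by
    convert! ((((hasDerivAt_id x).sub_const μ).pow 2).neg.div_const (2 * (v : ℝ))) using 1
    simp
    field
  convert! (h1.exp.const_mul (√(2 * Real.pi * v))⁻¹) using 1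
  rw [gaussianPDFReal]
  ring

lemma integrable_gaussianReal_iff {μ : ℝ} {v : ℝ≥0} (hv : v ≠ 0) {f : ℝ → ℝ} :
    Integrable f (gaussianReal μ v) ↔ Integrable (fun x => gaussianPDFReal μ v x * f x) := by
  rw [gaussianReal_of_var_ne_zero _ hv, integrable_withDensity_iff_integrable_smul'
    (measurable_gaussianPDF _ _) (ae_of_all _ fun _ => gaussianPDF_lt_top)]
  simp [toReal_gaussianPDF]

/-- **Stein's lemma** for a real Gaussian distribution. -/
lemma integral_sub_mul_gaussianReal {μ : ℝ} {v : ℝ≥0} (hv : v ≠ 0) {g g' : ℝ → ℝ}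
    (hg : ∀ x, HasDerivAt g (g' x) x) (hg_int : Integrable g (gaussianReal μ v))
    (hg'_int : Integrable g' (gaussianReal μ v))
    (hxg_int : Integrable (fun x => (x - μ) * g x) (gaussianReal μ v)) :
    ∫ x, (x - μ) * g x ∂(gaussianReal μ v) = v * ∫ x, g' x ∂(gaussianReal μ v) := by
  have hv' : (v : ℝ) ≠ 0 := by exact_mod_cast hv
  rw [integrable_gaussianReal_iff hv] at hg_int hg'_int hxg_int
  have key := integral_mul_deriv_eq_deriv_mul_of_integrable
    (u := gaussianPDFReal μ v) (v := g)
    (fun x _ => hasDerivAt_gaussianPDFReal μ hv x) (fun x _ => hg x) hg'_int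
    ((hxg_int.const_mul (-(v : ℝ)⁻¹)).congr (ae_of_all _ fun x => by simp; ring)) hg_int
  rw [integral_gaussianReal_eq_integral_smul hv, integral_gaussianReal_eq_integral_smul hv]
  simp only [smul_eq_mul]
  rw [key, ← integral_neg, ← integral_const_mul]
  congr with x
  field

lemma abs_div_add_le {x S ε : ℝ} (hε : 0 < ε) (hx : x ^ 2 ≤ S) : |x / (S + ε)| ≤ 1 + 1 / ε := by
  have hS : 0 ≤ S := (sq_nonneg x).trans hx
  rw [abs_div, abs_of_pos (by positivity : 0 < S + ε), div_le_iff₀ (by positivity)]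
  have h1 : (1 + 1 / ε) * (S + ε) = S + ε + S / ε + 1 := by field
  have h2 : 0 ≤ S / ε := by positivity
  rw [h1]
  nlinarith [sq_nonneg (|x| - 1), sq_abs x]

lemma abs_add_sub_two_mul_sq_div_sq_le {x S ε : ℝ} (hε : 0 < ε) (hx : x ^ 2 ≤ S) :
    |(S + ε - 2 * x ^ 2) / (S + ε) ^ 2| ≤ 1 / ε := by
  have hx' := sq_nonneg x
  have hS : 0 ≤ S := hx'.trans hx
  rw [abs_div, abs_of_pos (by positivity : 0 < (S + ε) ^ 2),
    div_le_div_iff₀ (by positivity) hε, one_mul]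
  have h : |S + ε - 2 * x ^ 2| ≤ S + ε := by
    rw [abs_le]; constructor <;> linarith
  nlinarith

/-- Stein's lemma for the function `x / (x² + c)`. -/
lemma integral_sub_mul_div_sq_add_gaussianReal (μ : ℝ) {c : ℝ} (hc : 0 < c) :
    ∫ x, (x - μ) * (x / (x ^ 2 + c)) ∂(gaussianReal μ 1) =
      ∫ x, (x ^ 2 + c - 2 * x ^ 2) / (x ^ 2 + c) ^ 2 ∂(gaussianReal μ 1) := by
  have hpos (x : ℝ) : x ^ 2 + c ≠ 0 := by positivity
  have hm : AEStronglyMeasurable (fun x : ℝ => x / (x ^ 2 + c)) (gaussianReal μ 1) :=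
    Measurable.aestronglyMeasurable (by fun_prop)
  have hb (x : ℝ) : ‖x / (x ^ 2 + c)‖ ≤ 1 + 1 / c := abs_div_add_le hc le_rfl
  have hd (x : ℝ) : HasDerivAt (fun x : ℝ => x / (x ^ 2 + c))
      ((x ^ 2 + c - 2 * x ^ 2) / (x ^ 2 + c) ^ 2) x := by
    convert! (hasDerivAt_id x).div (((hasDerivAt_id x).pow 2).add_const c) (hpos x) using 2
    simp
    ring
  have hid : Integrable (fun x => x - μ) (gaussianReal μ 1) :=
    ((memLp_id_gaussianReal 1).integrable le_rfl).sub (integrable_const μ)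
  simpa using integral_sub_mul_gaussianReal one_ne_zero hd
    (.of_bound hm _ (ae_of_all _ hb))
    (.of_bound (Measurable.aestronglyMeasurable (by fun_prop)) (1 / c)
      (ae_of_all _ fun x => abs_add_sub_two_mul_sq_div_sq_le hc le_rfl))
    (hid.mul_bdd hm (ae_of_all _ hb))

section Pi

variable {n : ℕ} (θ : Fin n → ℝ) (i : Fin n) {ε : ℝ}

lemma integrable_eval_sub_gaussianReal :
    Integrable (fun y : Fin n → ℝ => y i - θ i) (Measure.pi fun i => gaussianReal (θ i) 1) :=
  integrable_comp_eval (μ := fun i => gaussianReal (θ i) 1) (f := fun x => x - θ i)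
    (((memLp_id_gaussianReal 1).integrable le_rfl).sub (integrable_const (θ i)))

lemma integrable_sub_mul_div_sum_sq_add (hε : 0 < ε) :
    Integrable (fun y : Fin n → ℝ => (y i - θ i) * (y i / (∑ j, y j ^ 2 + ε)))
      (Measure.pi fun i => gaussianReal (θ i) 1) :=
  (integrable_eval_sub_gaussianReal θ i).mul_bdd (c := 1 + 1 / ε)
    (Measurable.aestronglyMeasurable (by fun_prop))
    (ae_of_all _ fun y => abs_div_add_le hε
      (Finset.single_le_sum (fun j _ => sq_nonneg (y j)) (Finset.mem_univ i)))

lemma integrable_sum_sq_add_sub_div_sq (hε : 0 < ε) :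
    Integrable (fun y : Fin n → ℝ =>
      (∑ j, y j ^ 2 + ε - 2 * y i ^ 2) / (∑ j, y j ^ 2 + ε) ^ 2)
      (Measure.pi fun i => gaussianReal (θ i) 1) :=
  .of_bound (Measurable.aestronglyMeasurable (by fun_prop)) (1 / ε)
    (ae_of_all _ fun y => abs_add_sub_two_mul_sq_div_sq_le hε
      (Finset.single_le_sum (fun j _ => sq_nonneg (y j)) (Finset.mem_univ i)))

/-- Stein's lemma for a coordinate of the field `y / (‖y‖² + ε)`. -/
lemma integral_sub_mul_div_sum_sq_add (hε : 0 < ε) :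
    ∫ y : Fin n → ℝ, (y i - θ i) * (y i / (∑ j, y j ^ 2 + ε))
      ∂(Measure.pi fun i => gaussianReal (θ i) 1) =
    ∫ y : Fin n → ℝ, (∑ j, y j ^ 2 + ε - 2 * y i ^ 2) / (∑ j, y j ^ 2 + ε) ^ 2
      ∂(Measure.pi fun i => gaussianReal (θ i) 1) := by
  cases n with
  | zero => exact i.elim0
  | succ m =>
    have hf := integrable_sub_mul_div_sum_sq_add θ i hε
    have hf' := integrable_sum_sq_add_sub_div_sq θ i hε
    have mp := (measurePreserving_piFinSuccAbove (fun i => gaussianReal (θ i) 1) i).symm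
    rw [← mp.integrable_comp_emb (MeasurableEquiv.measurableEmbedding _)] at hf hf'
    rw [← mp.integral_comp', ← mp.integral_comp']
    refine (integral_prod_symm _ hf).trans (Eq.trans ?_ (integral_prod_symm _ hf').symm)
    congr with z
    have hc : 0 < ∑ j, z j ^ 2 + ε := by positivity
    have he (x : ℝ) : (MeasurableEquiv.piFinSuccAbove (fun _ => ℝ) i).symm (x, z) =
        i.insertNth x z := rfl
    simpa [he, Fin.sum_univ_succAbove _ i, add_assoc] using
      integral_sub_mul_div_sq_add_gaussianReal (θ i) hc

lemma integrable_one_div_sum_sq_add (hε : 0 < ε) :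
    Integrable (fun y : Fin n → ℝ => 1 / (∑ j, y j ^ 2 + ε))
      (Measure.pi fun i => gaussianReal (θ i) 1) :=
  .of_bound (Measurable.aestronglyMeasurable (by fun_prop)) (1 / ε) (ae_of_all _ fun y => by
    have h : 0 ≤ ∑ j, y j ^ 2 := by positivity
    rw [Real.norm_of_nonneg (by positivity)]
    gcongr
    linarith)

lemma sub_two_mul_integral_one_div_le (hε : 0 < ε) :
    ((n : ℝ) - 2) * ∫ y : Fin n → ℝ, 1 / (∑ j, y j ^ 2 + ε)
      ∂(Measure.pi fun i => gaussianReal (θ i) 1) ≤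
    ∫ y : Fin n → ℝ, ∑ i, (y i - θ i) * (y i / (∑ j, y j ^ 2 + ε))
      ∂(Measure.pi fun i => gaussianReal (θ i) 1) := by
  rw [integral_finsetSum _ fun i _ => integrable_sub_mul_div_sum_sq_add θ i hε]
  simp_rw [integral_sub_mul_div_sum_sq_add θ _ hε]
  rw [← integral_finsetSum _ fun i _ => integrable_sum_sq_add_sub_div_sq θ i hε,
    ← integral_const_mul]
  refine integral_mono ((integrable_one_div_sum_sq_add θ hε).const_mul _)
    (integrable_finsetSum _ fun i _ => integrable_sum_sq_add_sub_div_sq θ i hε) fun y => ?_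
  have hS : 0 ≤ ∑ j, y j ^ 2 := by positivity
  simp only
  rw [← Finset.sum_div, Finset.sum_sub_distrib, ← Finset.mul_sum, Finset.sum_const,
    Finset.card_univ, Fintype.card_fin, nsmul_eq_mul, mul_one_div,
    div_le_div_iff₀ (by positivity) (by positivity)]
  set S := ∑ j, y j ^ 2
  have : 0 ≤ 2 * ε * (S + ε) := by positivity
  nlinarith

lemma abs_sum_sub_mul_div_le (y : Fin n → ℝ) {T : ℝ} (hT : 0 < T) (hyT : ∑ j, y j ^ 2 ≤ T) :
    |∑ i, (y i - θ i) * (y i / T)| ≤ 1 + (∑ i, θ i ^ 2) / 2 + 1 / T / 2 := by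
  have hS : 0 ≤ ∑ j, y j ^ 2 := by positivity
  have h1 : ∑ i, (y i - θ i) * (y i / T) = (∑ j, y j ^ 2) / T - ∑ i, θ i * (y i / T) := by
    rw [Finset.sum_div, ← Finset.sum_sub_distrib]
    congr with i
    ring
  have h2 : |∑ i, θ i * (y i / T)| ≤ (∑ i, θ i ^ 2) / 2 + (∑ j, y j ^ 2) / T ^ 2 / 2 := by
    rw [Finset.sum_div, Finset.sum_div, Finset.sum_div, ← Finset.sum_add_distrib]
    refine (Finset.abs_sum_le_sum_abs _ _).trans (Finset.sum_le_sum fun i _ => ?_)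
    rw [← div_pow, abs_le]
    constructor <;> nlinarith [sq_nonneg (θ i - y i / T), sq_nonneg (θ i + y i / T)]
  have h3 : (∑ j, y j ^ 2) / T ^ 2 ≤ 1 / T := by
    rw [div_le_div_iff₀ (by positivity) hT]
    nlinarith
  have h4 : (∑ j, y j ^ 2) / T ≤ 1 := (div_le_one hT).2 hyT
  have h5 : 0 ≤ (∑ j, y j ^ 2) / T := by positivity
  rw [h1]
  rw [abs_le] at h2 ⊢
  constructor <;> linarith

lemma integral_one_div_sum_sq_add_le (hn : 3 ≤ n) (hε : 0 < ε) :
    ∫ y : Fin n → ℝ, 1 / (∑ j, y j ^ 2 + ε) ∂(Measure.pi fun i => gaussianReal (θ i) 1) ≤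
      2 + ∑ i, θ i ^ 2 := by
  have hI := integrable_one_div_sum_sq_add θ hε
  have h0 : 0 ≤ ∫ y : Fin n → ℝ, 1 / (∑ j, y j ^ 2 + ε)
      ∂(Measure.pi fun i => gaussianReal (θ i) 1) :=
    integral_nonneg fun y => by
      have hS : 0 ≤ ∑ j, y j ^ 2 := by positivity
      positivity
  have h1 := sub_two_mul_integral_one_div_le θ hε
  have h2 := integral_mono (integrable_finsetSum Finset.univ fun i _ =>
      integrable_sub_mul_div_sum_sq_add θ i hε)
    ((integrable_const (1 + (∑ i, θ i ^ 2) / 2)).add (hI.div_const 2)) fun y => by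
      have hS : 0 ≤ ∑ j, y j ^ 2 := by positivity
      exact (le_abs_self _).trans
        (abs_sum_sub_mul_div_le θ y (by positivity) (by linarith))
  simp only [Pi.add_apply] at h2
  rw [integral_add (integrable_const _) (hI.div_const 2), integral_div] at h2
  simp only [integral_const, probReal_univ, one_smul] at h2
  have hn' : (3 : ℝ) ≤ n := by exact_mod_cast hn
  nlinarith

lemma ae_sum_sq_pos (hn : 3 ≤ n) :
    ∀ᵐ y ∂(Measure.pi fun i => gaussianReal (θ i) 1), 0 < ∑ j, y j ^ 2 := by
  have (i : Fin n) : NullSingletonClass (gaussianReal (θ i) 1) :=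
    nullSingletonClass_gaussianReal one_ne_zero
  filter_upwards [Measure.ae_eval_ne (μ := fun i => gaussianReal (θ i) 1)
    (⟨0, by omega⟩ : Fin n) 0] with y hy
  exact (sq_pos_of_ne_zero hy).trans_le
    (Finset.single_le_sum (fun j _ => sq_nonneg (y j)) (Finset.mem_univ _))

lemma tendsto_add_one_div_nat (S : ℝ) :
    Tendsto (fun k : ℕ => S + 1 / ((k : ℝ) + 1)) atTop (𝓝 S) := by
  simpa using tendsto_one_div_add_atTop_nhds_zero_nat.const_add S

lemma integrable_one_div_sum_sq (hn : 3 ≤ n) :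
    Integrable (fun y : Fin n → ℝ => 1 / (∑ j, y j ^ 2))
      (Measure.pi fun i => gaussianReal (θ i) 1) := by
  refine ⟨Measurable.aestronglyMeasurable (by fun_prop), ?_⟩
  rw [hasFiniteIntegral_iff_ofReal (ae_of_all _ fun y => by positivity)]
  calc ∫⁻ y : Fin n → ℝ, ENNReal.ofReal (1 / (∑ j, y j ^ 2))
        ∂(Measure.pi fun i => gaussianReal (θ i) 1)
      = ∫⁻ y : Fin n → ℝ, liminf (fun k : ℕ =>
          ENNReal.ofReal (1 / (∑ j, y j ^ 2 + 1 / ((k : ℝ) + 1)))) atTop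
        ∂(Measure.pi fun i => gaussianReal (θ i) 1) := by
        refine lintegral_congr_ae ?_
        filter_upwards [ae_sum_sq_pos θ hn] with y hy
        exact (ENNReal.tendsto_ofReal
          (tendsto_const_nhds.div (tendsto_add_one_div_nat _) hy.ne')).liminf_eq.symm
    _ ≤ liminf (fun k : ℕ => ∫⁻ y : Fin n → ℝ,
          ENNReal.ofReal (1 / (∑ j, y j ^ 2 + 1 / ((k : ℝ) + 1)))
        ∂(Measure.pi fun i => gaussianReal (θ i) 1)) atTop :=
        lintegral_liminf_le fun k => by fun_prop
    _ ≤ liminf (fun _ : ℕ => ENNReal.ofReal (2 + ∑ i, θ i ^ 2)) atTop := by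
        refine liminf_le_liminf (Eventually.of_forall fun k => ?_)
        have hk : 0 < 1 / ((k : ℝ) + 1) := by positivity
        rw [← ofReal_integral_eq_lintegral_ofReal (integrable_one_div_sum_sq_add θ hk)
          (ae_of_all _ fun y => ?_)]
        · exact ENNReal.ofReal_le_ofReal (integral_one_div_sum_sq_add_le θ hn hk)
        · have hS : 0 ≤ ∑ j, y j ^ 2 := by positivity
          simp only [Pi.zero_apply]
          positivity
    _ < ⊤ := by simp

lemma integral_one_div_sum_sq_pos (hn : 3 ≤ n) :
    0 < ∫ y : Fin n → ℝ, 1 / (∑ j, y j ^ 2) ∂(Measure.pi fun i => gaussianReal (θ i) 1) := by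
  have h0 : 0 ≤ fun y : Fin n → ℝ => 1 / (∑ j, y j ^ 2) := fun y => by
    simp only [Pi.zero_apply]
    positivity
  refine (integral_nonneg h0).lt_of_ne' fun h => ?_
  rw [integral_eq_zero_iff_of_nonneg h0 (integrable_one_div_sum_sq θ hn)] at h
  obtain ⟨y, hy, hy'⟩ := (h.and (ae_sum_sq_pos θ hn)).exists
  simp only [Pi.zero_apply] at hy
  have : 0 < 1 / (∑ j, y j ^ 2) := by positivity
  exact this.ne' hy

lemma integrable_sum_sub_mul_div_sum_sq (hn : 3 ≤ n) :
    Integrable (fun y : Fin n → ℝ => ∑ i, (y i - θ i) * (y i / (∑ j, y j ^ 2)))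
      (Measure.pi fun i => gaussianReal (θ i) 1) := by
  refine ((integrable_const (1 + (∑ i, θ i ^ 2) / 2)).add
    ((integrable_one_div_sum_sq θ hn).div_const 2)).mono'
    (Measurable.aestronglyMeasurable (by fun_prop)) ?_
  filter_upwards [ae_sum_sq_pos θ hn] with y hy
  exact abs_sum_sub_mul_div_le θ y hy le_rfl

lemma sub_two_mul_integral_one_div_sum_sq_le (hn : 3 ≤ n) :
    ((n : ℝ) - 2) * ∫ y : Fin n → ℝ, 1 / (∑ j, y j ^ 2)
      ∂(Measure.pi fun i => gaussianReal (θ i) 1) ≤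
    ∫ y : Fin n → ℝ, ∑ i, (y i - θ i) * (y i / (∑ j, y j ^ 2))
      ∂(Measure.pi fun i => gaussianReal (θ i) 1) := by
  have hI := integrable_one_div_sum_sq θ hn
  have hle (y : Fin n → ℝ) (k : ℕ) (hy : 0 < ∑ j, y j ^ 2) :
      1 / (∑ j, y j ^ 2 + 1 / ((k : ℝ) + 1)) ≤ 1 / (∑ j, y j ^ 2) :=
    one_div_le_one_div_of_le hy (le_add_of_nonneg_right (by positivity))
  refine le_of_tendsto_of_tendsto' (Tendsto.const_mul _
    (tendsto_integral_of_dominated_convergence (fun y : Fin n → ℝ => 1 / (∑ j, y j ^ 2))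
      (F := fun (k : ℕ) y => 1 / (∑ j, y j ^ 2 + 1 / ((k : ℝ) + 1)))
      (fun k => Measurable.aestronglyMeasurable (by fun_prop)) hI (fun k => ?_) ?_))
    (tendsto_integral_of_dominated_convergence
      (fun y : Fin n → ℝ => 1 + (∑ i, θ i ^ 2) / 2 + 1 / (∑ j, y j ^ 2) / 2)
      (F := fun (k : ℕ) y => ∑ i, (y i - θ i) * (y i / (∑ j, y j ^ 2 + 1 / ((k : ℝ) + 1))))
      (fun k => Measurable.aestronglyMeasurable (by fun_prop))
      ((integrable_const _).add (hI.div_const 2)) (fun k => ?_) ?_)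
    fun k => sub_two_mul_integral_one_div_le θ (by positivity)
  · filter_upwards [ae_sum_sq_pos θ hn] with y hy
    rw [Real.norm_of_nonneg (by positivity)]
    exact hle y k hy
  · filter_upwards [ae_sum_sq_pos θ hn] with y hy
    exact tendsto_const_nhds.div (tendsto_add_one_div_nat _) hy.ne'
  · filter_upwards [ae_sum_sq_pos θ hn] with y hy
    refine (abs_sum_sub_mul_div_le θ y (T := ∑ j, y j ^ 2 + 1 / ((k : ℝ) + 1)) (by positivity)
      (le_add_of_nonneg_right (by positivity))).trans ?_
    linarith [hle y k hy]
  · filter_upwards [ae_sum_sq_pos θ hn] with y hy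
    exact tendsto_finsetSum _ fun i _ =>
      (tendsto_const_nhds.div (tendsto_add_one_div_nat _) hy.ne').const_mul _

lemma integrable_eval_sub_sq_gaussianReal :
    Integrable (fun y : Fin n → ℝ => (y i - θ i) ^ 2)
      (Measure.pi fun i => gaussianReal (θ i) 1) :=
  integrable_comp_eval (μ := fun i => gaussianReal (θ i) 1) (f := fun x => (x - θ i) ^ 2)
    (((memLp_id_gaussianReal 2).sub (memLp_const (θ i))).integrable_sq)

lemma integral_sum_sub_sq_gaussianReal :
    ∫ y : Fin n → ℝ, ∑ i, (y i - θ i) ^ 2 ∂(Measure.pi fun i => gaussianReal (θ i) 1) = n := by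
  rw [integral_finsetSum _ fun i _ => integrable_eval_sub_sq_gaussianReal θ i]
  have h (i : Fin n) : ∫ y : Fin n → ℝ, (y i - θ i) ^ 2
      ∂(Measure.pi fun i => gaussianReal (θ i) 1) = 1 := by
    rw [integral_comp_eval (μ := fun i => gaussianReal (θ i) 1) (f := fun x => (x - θ i) ^ 2)
      (Measurable.aestronglyMeasurable (by fun_prop))]
    have hv := variance_fun_id_gaussianReal (μ := θ i) (v := 1)
    rw [variance_eq_integral (by fun_prop), integral_id_gaussianReal] at hv
    simpa using hv
  simp [h]

lemma sum_jamesStein_sub_sq (y : Fin n → ℝ) :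
    ∑ i, ((1 - ((n : ℝ) - 2) / (∑ j, y j ^ 2)) * y i - θ i) ^ 2 =
      ∑ i, (y i - θ i) ^ 2 - 2 * ((n : ℝ) - 2) * ∑ i, (y i - θ i) * (y i / (∑ j, y j ^ 2)) +
        ((n : ℝ) - 2) ^ 2 * (1 / (∑ j, y j ^ 2)) := by
  have h : 1 / (∑ j, y j ^ 2) = ∑ i, (y i / (∑ j, y j ^ 2)) ^ 2 := by
    simp_rw [div_pow]
    rw [← Finset.sum_div]
    by_cases hS : ∑ j, y j ^ 2 = 0
    · simp [hS]
    · field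
  rw [h]
  rw [Finset.mul_sum, Finset.mul_sum, ← Finset.sum_sub_distrib, ← Finset.sum_add_distrib]
  refine Finset.sum_congr rfl fun i _ => ?_
  ring

end Pi

/-- For `n ≥ 3` and `Y ~ N(θ, I_n)`, the James–Stein estimator
`θ̂_JS(y) = (1 − (n−2)/‖y‖²)·y` uniformly dominates the MLE `Y` in total
squared-error risk: `E‖θ̂_JS(Y) − θ‖² < n = E‖Y − θ‖²` for every `θ ∈ ℝⁿ`. -/
theorem james_stein_dominates_mle (n : ℕ) (hn : 3 ≤ n) (θ : Fin n → ℝ) :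
    (∫ y : Fin n → ℝ,
        ∑ i, ((1 - ((n : ℝ) - 2) / (∑ j, y j ^ 2)) * y i - θ i) ^ 2
      ∂(Measure.pi fun i => gaussianReal (θ i) 1)) < (n : ℝ) ∧
    (∫ y : Fin n → ℝ, ∑ i, (y i - θ i) ^ 2
      ∂(Measure.pi fun i => gaussianReal (θ i) 1)) = (n : ℝ) := by
  refine ⟨?_, integral_sum_sub_sq_gaussianReal θ⟩
  have hL := integrable_finsetSum Finset.univ fun i _ => integrable_eval_sub_sq_gaussianReal θ i
  have hG := (integrable_sum_sub_mul_div_sum_sq θ hn).const_mul (2 * ((n : ℝ) - 2))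
  have hI := (integrable_one_div_sum_sq θ hn).const_mul (((n : ℝ) - 2) ^ 2)
  simp_rw [sum_jamesStein_sub_sq θ]
  rw [integral_add (by exact hL.sub hG) hI, integral_sub hL hG, integral_const_mul, integral_const_mul,
    integral_sum_sub_sq_gaussianReal θ]
  have h1 := sub_two_mul_integral_one_div_sum_sq_le θ hn
  have hn' : 0 < (n : ℝ) - 2 := by
    have : (3 : ℝ) ≤ n := by exact_mod_cast hn
    linarith
  have h2 := mul_pos (pow_pos hn' 2) (integral_one_div_sum_sq_pos θ hn)
  have h3 := mul_le_mul_of_nonneg_left h1 hn'.le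
  nlinarith
end

section
/- Let n ≥ 3 and Y ~ N(θ, I_n) with σ² = 1. The risk of the James–Stein estimator θ̂_JS(y) = (1 − (n−2)/‖y‖²)·y satisfies, for every θ ∈ ℝⁿ, the two-sided bound n‖θ‖²/(n + ‖θ‖²) ≤ E_{Y|θ}‖θ̂_JS(Y) − θ‖² ≤ 2 + n‖θ‖²/(n + ‖θ‖²). -/
open MeasureTheory ProbabilityTheory

/-- The Laplace transform at `s` of a noncentral chi-squared law with `2 * k` degrees of freedom
and noncentrality parameter `t`. -/
noncomputable def noncentralChiSqLaplace (k t s : ℝ) : ℝ :=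
  (1 + 2 * s) ^ (-k) * Real.exp (-(t * s / (1 + 2 * s)))

lemma noncentralChiSqLaplace_nonneg (k t : ℝ) {s : ℝ} (hs : 0 ≤ s) :
    0 ≤ noncentralChiSqLaplace k t s := by
  unfold noncentralChiSqLaplace
  positivity

lemma noncentralChiSqLaplace_add_one (k t : ℝ) {s : ℝ} (hs : 0 ≤ s) :
    noncentralChiSqLaplace (k + 1) t s = noncentralChiSqLaplace k t s / (1 + 2 * s) := by
  unfold noncentralChiSqLaplace
  rw [neg_add, Real.rpow_add (by positivity), Real.rpow_neg_one]
  ring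

lemma noncentralChiSqLaplace_add_one_le (k t : ℝ) {s : ℝ} (hs : 0 ≤ s) :
    noncentralChiSqLaplace (k + 1) t s ≤ noncentralChiSqLaplace k t s := by
  rw [noncentralChiSqLaplace_add_one k t hs]
  exact div_le_self (noncentralChiSqLaplace_nonneg k t hs) (by linarith)

lemma measurable_noncentralChiSqLaplace (k t : ℝ) :
    Measurable (noncentralChiSqLaplace k t) := by
  unfold noncentralChiSqLaplace
  fun_prop

lemma hasDerivAt_noncentralChiSqLaplace (k t : ℝ) {s : ℝ} (hs : 0 ≤ s) :
    HasDerivAt (noncentralChiSqLaplace k t)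
      (-(2 * k * noncentralChiSqLaplace (k + 1) t s
        + t * noncentralChiSqLaplace (k + 1 + 1) t s)) s := by
  have hpos : 0 < 1 + 2 * s := by positivity
  have h1 : HasDerivAt (fun x : ℝ => 1 + 2 * x) 2 s := by
    simpa using ((hasDerivAt_id s).const_mul 2).const_add 1
  have h2 : HasDerivAt (fun x : ℝ => t * x) t s := by
    simpa using (hasDerivAt_id s).const_mul t
  have h := (h1.rpow_const (p := -k) (Or.inl hpos.ne')).mul
    ((h2.div h1 hpos.ne').neg.exp)
  refine h.congr_deriv ?_
  rw [noncentralChiSqLaplace_add_one (k + 1) t hs, noncentralChiSqLaplace_add_one k t hs,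
    noncentralChiSqLaplace, Real.rpow_sub_one hpos.ne']
  simp only [Pi.div_apply, Pi.neg_apply]
  field_simp
  ring

lemma tendsto_noncentralChiSqLaplace {k t : ℝ} (hk : 0 < k) (ht : 0 ≤ t) :
    Filter.Tendsto (noncentralChiSqLaplace k t) Filter.atTop (nhds 0) := by
  have h1 : Filter.Tendsto (fun s : ℝ => 1 + 2 * s) Filter.atTop Filter.atTop :=
    Filter.tendsto_atTop_add_const_left _ _
      (Filter.tendsto_id.const_mul_atTop (by norm_num))
  refine squeeze_zero' (g := fun s : ℝ => (1 + 2 * s) ^ (-k)) ?_ ?_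
    ((tendsto_rpow_neg_atTop hk).comp h1)
  · filter_upwards [Filter.eventually_ge_atTop 0] with s hs
    exact noncentralChiSqLaplace_nonneg k t hs
  · filter_upwards [Filter.eventually_ge_atTop 0] with s hs
    refine mul_le_of_le_one_right (by positivity) (Real.exp_le_one_iff.2 ?_)
    have : 0 ≤ t * s / (1 + 2 * s) := by positivity
    linarith

lemma integrableOn_noncentralChiSqLaplace {k t : ℝ} (hk : 0 < k) (ht : 0 ≤ t) :
    IntegrableOn (noncentralChiSqLaplace (k + 1) t) (Set.Ioi 0) := by
  have h := (integrableOn_Ioi_deriv_of_nonpos'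
    (fun s hs => hasDerivAt_noncentralChiSqLaplace k t hs) (fun s hs => ?_)
    (tendsto_noncentralChiSqLaplace hk ht)).const_mul (-(2 * k)⁻¹)
  · refine h.mono' (measurable_noncentralChiSqLaplace _ _).aestronglyMeasurable ?_
    filter_upwards [ae_restrict_mem measurableSet_Ioi] with s hs
    have hs' : 0 ≤ s := hs.le
    have h1 := noncentralChiSqLaplace_nonneg (k + 1) t hs'
    have h2 := noncentralChiSqLaplace_nonneg (k + 1 + 1) t hs'
    rw [Real.norm_of_nonneg h1, neg_mul_neg, ← div_eq_inv_mul, le_div_iff₀ (by positivity)]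
    nlinarith [mul_nonneg ht h2]
  · have h1 := noncentralChiSqLaplace_nonneg (k + 1) t (le_of_lt hs)
    have h2 := noncentralChiSqLaplace_nonneg (k + 1 + 1) t (le_of_lt hs)
    have : 0 ≤ 2 * k * noncentralChiSqLaplace (k + 1) t s
        + t * noncentralChiSqLaplace (k + 1 + 1) t s := by positivity
    linarith

/-- The recurrence between inverse moments of noncentral chi-squared laws. -/
lemma integral_noncentralChiSqLaplace_recurrence {k t : ℝ} (hk : 0 < k) (ht : 0 ≤ t) :
    2 * k * (∫ s in Set.Ioi 0, noncentralChiSqLaplace (k + 1) t s)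
      + t * (∫ s in Set.Ioi 0, noncentralChiSqLaplace (k + 1 + 1) t s) = 1 := by
  have h := integral_Ioi_of_hasDerivAt_of_nonpos'
    (fun s hs => hasDerivAt_noncentralChiSqLaplace k t hs) (fun s hs => ?_)
    (tendsto_noncentralChiSqLaplace hk ht)
  · rw [integral_neg, integral_add ((integrableOn_noncentralChiSqLaplace hk ht).const_mul _)
      ((integrableOn_noncentralChiSqLaplace (by positivity) ht).const_mul _),
      integral_const_mul, integral_const_mul] at h
    have h0 : noncentralChiSqLaplace k t 0 = 1 := by simp [noncentralChiSqLaplace]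
    linarith
  · have h1 := noncentralChiSqLaplace_nonneg (k + 1) t (le_of_lt hs)
    have h2 := noncentralChiSqLaplace_nonneg (k + 1 + 1) t (le_of_lt hs)
    have : 0 ≤ 2 * k * noncentralChiSqLaplace (k + 1) t s
        + t * noncentralChiSqLaplace (k + 1 + 1) t s := by positivity
    linarith

lemma integral_noncentralChiSqLaplace_add_one_le {k t : ℝ} (hk : 0 < k) (ht : 0 ≤ t) :
    ∫ s in Set.Ioi 0, noncentralChiSqLaplace (k + 1 + 1) t s
      ≤ ∫ s in Set.Ioi 0, noncentralChiSqLaplace (k + 1) t s :=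
  setIntegral_mono_on (integrableOn_noncentralChiSqLaplace (by positivity) ht)
    (integrableOn_noncentralChiSqLaplace hk ht) measurableSet_Ioi
    fun _ hs => noncentralChiSqLaplace_add_one_le _ _ (le_of_lt hs)

lemma integral_mul_exp_neg_sq_gaussianReal (a : ℝ) {s : ℝ} (hs : 0 ≤ s) (f : ℝ → ℝ) :
    ∫ y, f y * Real.exp (-(s * y ^ 2)) ∂(gaussianReal a 1)
      = noncentralChiSqLaplace (1 / 2) (a ^ 2) s
        * ∫ y, f y ∂(gaussianReal (a / (1 + 2 * s)) (Real.toNNReal (1 + 2 * s)⁻¹)) := by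
  have hpos : 0 < 1 + 2 * s := by positivity
  have hv : Real.toNNReal (1 + 2 * s)⁻¹ ≠ 0 := by simpa using hpos
  rw [integral_gaussianReal_eq_integral_smul one_ne_zero,
    integral_gaussianReal_eq_integral_smul hv, ← integral_const_mul]
  congr 1 with y
  simp only [gaussianPDFReal, noncentralChiSqLaplace, smul_eq_mul, NNReal.coe_one,
    Real.coe_toNNReal _ (inv_nonneg.2 hpos.le)]
  rw [Real.rpow_neg hpos.le, ← Real.sqrt_eq_rpow, Real.sqrt_mul (by positivity) (1 + 2 * s)⁻¹,
    Real.sqrt_inv, mul_one]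
  have hexp : Real.exp (-(y - a) ^ 2 / (2 * 1)) * Real.exp (-(s * y ^ 2))
      = Real.exp (-(a ^ 2 * s / (1 + 2 * s)))
        * Real.exp (-(y - a / (1 + 2 * s)) ^ 2 / (2 * (1 + 2 * s)⁻¹)) := by
    rw [← Real.exp_add, ← Real.exp_add]
    congr 1
    field_simp
    ring
  have hsq : √(1 + 2 * s) ≠ 0 := (Real.sqrt_pos.2 hpos).ne'
  rw [mul_one] at hexp
  calc _ = (√(2 * Real.pi))⁻¹ * f y
        * (Real.exp (-(y - a) ^ 2 / 2) * Real.exp (-(s * y ^ 2))) := by ring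
    _ = _ := by
      rw [hexp]
      field_simp

lemma integral_exp_neg_sq_gaussianReal (a : ℝ) {s : ℝ} (hs : 0 ≤ s) :
    ∫ y, Real.exp (-(s * y ^ 2)) ∂(gaussianReal a 1)
      = noncentralChiSqLaplace (1 / 2) (a ^ 2) s := by
  simpa using integral_mul_exp_neg_sq_gaussianReal a hs fun _ => 1

lemma integral_id_mul_exp_neg_sq_gaussianReal (a : ℝ) {s : ℝ} (hs : 0 ≤ s) :
    ∫ y, y * Real.exp (-(s * y ^ 2)) ∂(gaussianReal a 1)
      = a / (1 + 2 * s) * noncentralChiSqLaplace (1 / 2) (a ^ 2) s := by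
  rw [integral_mul_exp_neg_sq_gaussianReal a hs fun y => y, integral_id_gaussianReal, mul_comm]

lemma prod_noncentralChiSqLaplace {ι : Type*} [Fintype ι] (θ : ι → ℝ) {s : ℝ} (hs : 0 ≤ s) :
    ∏ i, noncentralChiSqLaplace (1 / 2) (θ i ^ 2) s
      = noncentralChiSqLaplace (Fintype.card ι / 2) (∑ i, θ i ^ 2) s := by
  unfold noncentralChiSqLaplace
  rw [Finset.prod_mul_distrib, ← Real.exp_sum, Finset.sum_neg_distrib, Finset.prod_const,
    ← Finset.sum_div, ← Finset.sum_mul, ← Real.rpow_mul_natCast (by positivity),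
    Finset.card_univ]
  congr 2
  ring

lemma integral_exp_neg_sum_sq_pi_gaussianReal {ι : Type*} [Fintype ι] (θ : ι → ℝ) {s : ℝ}
    (hs : 0 ≤ s) :
    ∫ y : ι → ℝ, Real.exp (-(s * ∑ j, y j ^ 2)) ∂(Measure.pi fun i => gaussianReal (θ i) 1)
      = noncentralChiSqLaplace (Fintype.card ι / 2) (∑ i, θ i ^ 2) s := by
  rw [← prod_noncentralChiSqLaplace θ hs]
  simp_rw [← integral_exp_neg_sq_gaussianReal _ hs]
  rw [← integral_fintype_prod_eq_prod (fun _ x => Real.exp (-(s * x ^ 2)))]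
  simp_rw [← Real.exp_sum, Finset.mul_sum, Finset.sum_neg_distrib]

lemma integral_eval_mul_exp_neg_sum_sq_pi_gaussianReal {ι : Type*} [Fintype ι] (θ : ι → ℝ)
    (i : ι) {s : ℝ} (hs : 0 ≤ s) :
    ∫ y : ι → ℝ, y i * Real.exp (-(s * ∑ j, y j ^ 2))
        ∂(Measure.pi fun i => gaussianReal (θ i) 1)
      = θ i * noncentralChiSqLaplace (Fintype.card ι / 2 + 1) (∑ i, θ i ^ 2) s := by
  classical
  have h := integral_fintype_prod_eq_prod (μ := fun i => gaussianReal (θ i) 1)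
    (fun j x => (if j = i then x else 1) * Real.exp (-(s * x ^ 2)))
  have hj (j : ι) : ∫ x, (if j = i then x else 1) * Real.exp (-(s * x ^ 2))
      ∂(gaussianReal (θ j) 1) = (if j = i then θ j / (1 + 2 * s) else 1)
        * noncentralChiSqLaplace (1 / 2) (θ j ^ 2) s := by
    split_ifs
    · exact integral_id_mul_exp_neg_sq_gaussianReal _ hs
    · simpa using integral_exp_neg_sq_gaussianReal (θ j) hs
  simp_rw [hj, Finset.prod_mul_distrib, prod_noncentralChiSqLaplace θ hs, ← Real.exp_sum,
    Finset.prod_ite_eq', Finset.sum_neg_distrib, ← Finset.mul_sum] at h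
  simp only [Finset.mem_univ, if_true] at h
  rw [h, noncentralChiSqLaplace_add_one _ _ hs]
  ring

lemma ae_sum_sq_pos_pi_gaussianReal {ι : Type*} [Fintype ι] [Nonempty ι] (θ : ι → ℝ) :
    ∀ᵐ y ∂(Measure.pi fun i => gaussianReal (θ i) 1), 0 < ∑ j, y j ^ 2 := by
  have h : ∀ᵐ y ∂(Measure.pi fun i => gaussianReal (θ i) 1), y ≠ 0 := by
    have (i : ι) : NullSingletonClass (gaussianReal (θ i) 1) :=
      nullSingletonClass_gaussianReal one_ne_zero
    have := Measure.pi_nullSingletonClass (μ := fun i => gaussianReal (θ i) 1)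
      (Classical.arbitrary ι)
    exact Measure.ae_ne _ _
  filter_upwards [h] with y hy
  obtain ⟨i, hi⟩ := Function.ne_iff.1 hy
  exact Finset.sum_pos' (fun j _ => sq_nonneg _) ⟨i, Finset.mem_univ _, sq_pos_of_ne_zero hi⟩

lemma integral_Ioi_exp_neg_mul {a : ℝ} (ha : 0 < a) :
    ∫ s in Set.Ioi 0, Real.exp (-(s * a)) = a⁻¹ := by
  have h := integral_exp_mul_Ioi (neg_neg_of_pos ha) 0
  simp only [neg_mul, mul_comm a] at h
  rw [h]
  simp

lemma integrableOn_Ioi_exp_neg_mul {a : ℝ} (ha : 0 < a) :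
    IntegrableOn (fun s => Real.exp (-(s * a))) (Set.Ioi 0) := by
  have h := integrableOn_exp_mul_Ioi (neg_neg_of_pos ha) 0
  simpa only [neg_mul, mul_comm a] using h

section InverseMoments

variable {ι : Type*} [Fintype ι]

lemma integrable_exp_neg_mul_sum_sq_prod (hι : 3 ≤ Fintype.card ι) (θ : ι → ℝ) :
    Integrable (fun p : (ι → ℝ) × ℝ => Real.exp (-(p.2 * ∑ j, p.1 j ^ 2)))
      ((Measure.pi fun i => gaussianReal (θ i) 1).prod (volume.restrict (Set.Ioi 0))) := by
  have hcard : (3 : ℝ) ≤ Fintype.card ι := by exact_mod_cast hι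
  rw [integrable_prod_iff' (by fun_prop)]
  constructor
  · filter_upwards [ae_restrict_mem measurableSet_Ioi] with s hs
    refine (integrable_const (1 : ℝ)).mono'
      (Measurable.aestronglyMeasurable (by fun_prop)) (ae_of_all _ fun y => ?_)
    rw [Real.norm_of_nonneg (Real.exp_nonneg _), Real.exp_le_one_iff, neg_nonpos]
    exact mul_nonneg (le_of_lt hs) (by positivity)
  · have h := integrableOn_noncentralChiSqLaplace (k := Fintype.card ι / 2 - 1)
      (t := ∑ i, θ i ^ 2) (by linarith) (by positivity)
    rw [sub_add_cancel] at h
    refine h.congr_fun (fun s hs => ?_) measurableSet_Ioi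
    simp only [Real.norm_of_nonneg (Real.exp_nonneg _)]
    exact (integral_exp_neg_sum_sq_pi_gaussianReal θ (le_of_lt hs)).symm

lemma integrable_inv_sum_sq_pi_gaussianReal (hι : 3 ≤ Fintype.card ι) (θ : ι → ℝ) :
    Integrable (fun y : ι → ℝ => (∑ j, y j ^ 2)⁻¹)
      (Measure.pi fun i => gaussianReal (θ i) 1) := by
  have : Nonempty ι := Fintype.card_pos_iff.1 (by omega)
  refine (integrable_exp_neg_mul_sum_sq_prod hι θ).integral_prod_left.congr ?_
  filter_upwards [ae_sum_sq_pos_pi_gaussianReal θ] with y hy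
  exact integral_Ioi_exp_neg_mul hy

lemma integral_inv_sum_sq_pi_gaussianReal (hι : 3 ≤ Fintype.card ι) (θ : ι → ℝ) :
    ∫ y : ι → ℝ, (∑ j, y j ^ 2)⁻¹ ∂(Measure.pi fun i => gaussianReal (θ i) 1)
      = ∫ s in Set.Ioi 0, noncentralChiSqLaplace (Fintype.card ι / 2) (∑ i, θ i ^ 2) s := by
  have : Nonempty ι := Fintype.card_pos_iff.1 (by omega)
  rw [← setIntegral_congr_fun measurableSet_Ioi
    fun s hs => integral_exp_neg_sum_sq_pi_gaussianReal θ (le_of_lt hs),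
    ← integral_integral_swap (integrable_exp_neg_mul_sum_sq_prod hι θ)]
  refine integral_congr_ae ?_
  filter_upwards [ae_sum_sq_pos_pi_gaussianReal θ] with y hy
  exact (integral_Ioi_exp_neg_mul hy).symm

lemma integrable_eval_div_sum_sq_pi_gaussianReal (hι : 3 ≤ Fintype.card ι) (θ : ι → ℝ) (i : ι) :
    Integrable (fun y : ι → ℝ => y i * (∑ j, y j ^ 2)⁻¹)
      (Measure.pi fun i => gaussianReal (θ i) 1) := by
  have : Nonempty ι := Fintype.card_pos_iff.1 (by omega)
  refine ((integrable_inv_sum_sq_pi_gaussianReal hι θ).add (integrable_const 1)).mono'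
    (by fun_prop) ?_
  filter_upwards [ae_sum_sq_pos_pi_gaussianReal θ] with y hy
  have hi : y i ^ 2 ≤ ∑ j, y j ^ 2 :=
    Finset.single_le_sum (f := fun j => y j ^ 2) (fun j _ => sq_nonneg _) (Finset.mem_univ i)
  have habs : |y i| ≤ 1 + ∑ j, y j ^ 2 := by
    nlinarith [sq_abs (y i), sq_nonneg (|y i| - 1)]
  rw [norm_mul, Real.norm_eq_abs, Real.norm_of_nonneg (inv_nonneg.2 hy.le)]
  calc |y i| * (∑ j, y j ^ 2)⁻¹ ≤ (1 + ∑ j, y j ^ 2) * (∑ j, y j ^ 2)⁻¹ := by gcongr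
    _ = (∑ j, y j ^ 2)⁻¹ + 1 := by rw [add_mul, one_mul, mul_inv_cancel₀ hy.ne']

lemma integral_eval_div_sum_sq_pi_gaussianReal (hι : 3 ≤ Fintype.card ι) (θ : ι → ℝ) (i : ι) :
    ∫ y : ι → ℝ, y i * (∑ j, y j ^ 2)⁻¹ ∂(Measure.pi fun i => gaussianReal (θ i) 1)
      = θ i * ∫ s in Set.Ioi 0,
          noncentralChiSqLaplace (Fintype.card ι / 2 + 1) (∑ i, θ i ^ 2) s := by
  have : Nonempty ι := Fintype.card_pos_iff.1 (by omega)
  have hint : Integrable (fun p : (ι → ℝ) × ℝ => p.1 i * Real.exp (-(p.2 * ∑ j, p.1 j ^ 2)))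
      ((Measure.pi fun i => gaussianReal (θ i) 1).prod (volume.restrict (Set.Ioi 0))) := by
    rw [integrable_prod_iff (by fun_prop)]
    constructor
    · filter_upwards [ae_sum_sq_pos_pi_gaussianReal θ] with y hy
      exact (integrableOn_Ioi_exp_neg_mul hy).const_mul _
    · refine (integrable_eval_div_sum_sq_pi_gaussianReal hι θ i).norm.congr ?_
      filter_upwards [ae_sum_sq_pos_pi_gaussianReal θ] with y hy
      simp only [norm_mul, Real.norm_of_nonneg (Real.exp_nonneg _), integral_const_mul,
        integral_Ioi_exp_neg_mul hy, Real.norm_of_nonneg (inv_nonneg.2 hy.le)]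
  rw [← integral_const_mul, ← setIntegral_congr_fun measurableSet_Ioi
    fun s hs => integral_eval_mul_exp_neg_sum_sq_pi_gaussianReal θ i (le_of_lt hs),
    ← integral_integral_swap hint]
  refine integral_congr_ae ?_
  filter_upwards [ae_sum_sq_pos_pi_gaussianReal θ] with y hy
  simp only [integral_const_mul, integral_Ioi_exp_neg_mul hy]

end InverseMoments

lemma integrable_sq_sub_gaussianReal (a : ℝ) :
    Integrable (fun x => (x - a) ^ 2) (gaussianReal a 1) :=
  ((memLp_id_gaussianReal 2).sub (memLp_const a)).integrable_sq

lemma integral_sq_sub_gaussianReal (a : ℝ) :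
    ∫ x, (x - a) ^ 2 ∂(gaussianReal a 1) = 1 := by
  have h := variance_fun_id_gaussianReal (μ := a) (v := 1)
  rw [variance_eq_integral measurable_id'.aemeasurable] at h
  simpa only [integral_id_gaussianReal, NNReal.coe_one] using h

/-- The exact risk of the James–Stein estimator. -/
lemma james_stein_risk_eq {ι : Type*} [Fintype ι] (hι : 3 ≤ Fintype.card ι) (θ : ι → ℝ) :
    ∫ y : ι → ℝ, ∑ i, ((1 - ((Fintype.card ι : ℝ) - 2) / (∑ j, y j ^ 2)) * y i - θ i) ^ 2
        ∂(Measure.pi fun i => gaussianReal (θ i) 1)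
      = Fintype.card ι - (Fintype.card ι - 2) ^ 2
        * ∫ s in Set.Ioi 0, noncentralChiSqLaplace (Fintype.card ι / 2) (∑ i, θ i ^ 2) s := by
  have : Nonempty ι := Fintype.card_pos_iff.1 (by omega)
  have hcard : (3 : ℝ) ≤ Fintype.card ι := by exact_mod_cast hι
  have hrec := integral_noncentralChiSqLaplace_recurrence (k := Fintype.card ι / 2 - 1)
    (t := ∑ i, θ i ^ 2) (by linarith) (by positivity)
  rw [sub_add_cancel] at hrec
  set c : ℝ := Fintype.card ι - 2 with hc
  have hpt : ∀ᵐ y ∂(Measure.pi fun i => gaussianReal (θ i) 1),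
      ∑ i, ((1 - c / (∑ j, y j ^ 2)) * y i - θ i) ^ 2
        = ∑ i, (y i - θ i) ^ 2 + (2 * c * ∑ i, θ i * (y i * (∑ j, y j ^ 2)⁻¹) - 2 * c)
          + c ^ 2 * (∑ j, y j ^ 2)⁻¹ := by
    filter_upwards [ae_sum_sq_pos_pi_gaussianReal θ] with y hy
    have hS : (∑ j, y j ^ 2) * (∑ j, y j ^ 2)⁻¹ = 1 := mul_inv_cancel₀ hy.ne'
    have hexpand (r : ℝ) : ∑ i, ((1 - c * r) * y i - θ i) ^ 2
        = ∑ i, (y i - θ i) ^ 2 + 2 * c * ∑ i, θ i * (y i * r) - 2 * c * ((∑ i, y i ^ 2) * r)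
          + c ^ 2 * r * ((∑ i, y i ^ 2) * r) := by
      simp only [Finset.mul_sum, Finset.sum_mul, ← Finset.sum_add_distrib,
        ← Finset.sum_sub_distrib]
      exact Finset.sum_congr rfl fun i _ => by ring
    rw [div_eq_mul_inv, hexpand, hS]
    ring
  have hsq (i : ι) : Integrable (fun y : ι → ℝ => (y i - θ i) ^ 2)
      (Measure.pi fun i => gaussianReal (θ i) 1) :=
    integrable_comp_eval (μ := fun i => gaussianReal (θ i) 1)
      (integrable_sq_sub_gaussianReal (θ i))
  have hsq' (i : ι) : ∫ y : ι → ℝ, (y i - θ i) ^ 2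
      ∂(Measure.pi fun i => gaussianReal (θ i) 1) = 1 :=
    (integral_comp_eval (μ := fun i => gaussianReal (θ i) 1)
      (integrable_sq_sub_gaussianReal (θ i)).aestronglyMeasurable).trans
      (integral_sq_sub_gaussianReal (θ i))
  have hcross (i : ι) := (integrable_eval_div_sum_sq_pi_gaussianReal hι θ i).const_mul (θ i)
  have hsum : Integrable (fun y : ι → ℝ => ∑ i, (y i - θ i) ^ 2)
      (Measure.pi fun i => gaussianReal (θ i) 1) := integrable_finsetSum _ fun i _ => hsq i
  have hcross' := (integrable_finsetSum Finset.univ fun i _ => hcross i).const_mul (2 * c)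
  have hcross'' : Integrable
      (fun y : ι → ℝ => 2 * c * ∑ i, θ i * (y i * (∑ j, y j ^ 2)⁻¹) - 2 * c)
      (Measure.pi fun i => gaussianReal (θ i) 1) := hcross'.sub (integrable_const _)
  have hinv := (integrable_inv_sum_sq_pi_gaussianReal hι θ).const_mul (c ^ 2)
  rw [integral_congr_ae hpt, integral_add (by exact hsum.add hcross'') hinv,
    integral_add hsum hcross'', integral_sub hcross' (integrable_const _),
    integral_const_mul (2 * c), integral_finsetSum _ fun i _ => hsq i,
    integral_finsetSum _ fun i _ => hcross i]
  simp only [hsq', integral_const_mul, integral_inv_sum_sq_pi_gaussianReal hι,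
    integral_eval_div_sum_sq_pi_gaussianReal hι]
  simp only [← mul_assoc, ← pow_two, ← Finset.sum_mul, Finset.sum_const, Finset.card_univ,
    nsmul_eq_mul, mul_one, integral_const, probReal_univ, smul_eq_mul, one_mul]
  linear_combination 2 * c * hrec

/-- For `n ≥ 3` and `Y ~ N(θ, I_n)`, the James–Stein risk satisfies the two-sided
bound `n‖θ‖²/(n + ‖θ‖²) ≤ E‖θ̂_JS(Y) − θ‖² ≤ 2 + n‖θ‖²/(n + ‖θ‖²)`. -/
theorem james_stein_risk_bounds (n : ℕ) (hn : 3 ≤ n) (θ : Fin n → ℝ) :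
    (n : ℝ) * (∑ i, θ i ^ 2) / ((n : ℝ) + ∑ i, θ i ^ 2)
      ≤ (∫ y : Fin n → ℝ,
          ∑ i, ((1 - ((n : ℝ) - 2) / (∑ j, y j ^ 2)) * y i - θ i) ^ 2
        ∂(Measure.pi fun i => gaussianReal (θ i) 1)) ∧
    (∫ y : Fin n → ℝ,
        ∑ i, ((1 - ((n : ℝ) - 2) / (∑ j, y j ^ 2)) * y i - θ i) ^ 2
      ∂(Measure.pi fun i => gaussianReal (θ i) 1))
      ≤ 2 + (n : ℝ) * (∑ i, θ i ^ 2) / ((n : ℝ) + ∑ i, θ i ^ 2) := by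
  have hn3 : (3 : ℝ) ≤ n := by exact_mod_cast hn
  have hrisk := james_stein_risk_eq (ι := Fin n) (by simpa using hn) θ
  simp only [Fintype.card_fin] at hrisk
  rw [hrisk]
  have ht : 0 ≤ ∑ i, θ i ^ 2 := by positivity
  generalize ∑ i, θ i ^ 2 = t at ht
  have hm : (0 : ℝ) < (n : ℝ) / 2 - 1 := by linarith
  have hrec := integral_noncentralChiSqLaplace_recurrence hm ht
  have hle := integral_noncentralChiSqLaplace_add_one_le hm ht
  have hrec' := integral_noncentralChiSqLaplace_recurrence (k := n / 2) (by linarith) ht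
  have hle' := integral_noncentralChiSqLaplace_add_one_le (add_pos hm one_pos) ht
  rw [sub_add_cancel] at hrec hle hle'
  generalize ∫ s in Set.Ioi 0, noncentralChiSqLaplace (n / 2) t s = H at *
  generalize ∫ s in Set.Ioi 0, noncentralChiSqLaplace (n / 2 + 1) t s = H₁ at *
  generalize ∫ s in Set.Ioi 0, noncentralChiSqLaplace (n / 2 + 1 + 1) t s = H₂ at *
  have hnt : (0 : ℝ) < n + t := by linarith
  -- The inverse moment satisfies `1 / (n - 2 + t) ≤ H ≤ n / ((n - 2) * (n + t))`.
  have hlower : 1 ≤ (n - 2 + t) * H := by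
    linarith [mul_le_mul_of_nonneg_left hle ht]
  have hupper₁ : 1 ≤ (n + t) * H₁ := by
    linarith [mul_le_mul_of_nonneg_left hle' ht]
  have hupper : (n + t) * ((n - 2) * H) ≤ n := by
    have : (n - 2) * H = 1 - t * H₁ := by linarith
    rw [this]
    nlinarith [mul_le_mul_of_nonneg_left hupper₁ ht]
  constructor
  · rw [div_le_iff₀ hnt]
    nlinarith [mul_le_mul_of_nonneg_left hupper (by linarith : (0 : ℝ) ≤ n - 2)]
  · have h₁ : n - (n - 2) ^ 2 * H ≤ 2 + (n - 2) * t / (n - 2 + t) := by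
      have hpos : (0 : ℝ) < n - 2 + t := by linarith
      have h : 1 / (n - 2 + t) ≤ H := by rwa [div_le_iff₀' hpos]
      calc n - (n - 2) ^ 2 * H ≤ n - (n - 2) ^ 2 * (1 / (n - 2 + t)) := by gcongr
        _ = 2 + (n - 2) * t / (n - 2 + t) := by
          field_simp
          ring
    refine h₁.trans (add_le_add_right ?_ 2)
    rw [div_le_div_iff₀ (by linarith) hnt]
    nlinarith [sq_nonneg t]
end

section
/- Let σ > 0 and let π be a probability measure on ℝ with ∫|θ| dπ(θ) < ∞. Define the marginal density m(y) = ∫ (1/√(2πσ²))·exp(−(y−θ)²/(2σ²)) dπ(θ). Then m is positive and differentiable on ℝ, and Tweedie's formula holds: the posterior mean of θ given y satisfies E(θ | y) = [∫ θ·(1/√(2πσ²))e^{−(y−θ)²/(2σ²)} dπ(θ)] / m(y) = y + σ²·(d/dy) log m(y) for every y ∈ ℝ. -/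
open MeasureTheory Real

/-- The density at `y` of the normal distribution with mean `θ` and variance `σ ^ 2`. -/
noncomputable def normalDensity (σ y θ : ℝ) : ℝ :=
  (1 / Real.sqrt (2 * π * σ ^ 2)) * Real.exp (-(y - θ) ^ 2 / (2 * σ ^ 2))

theorem normalDensity_pos {σ : ℝ} (hσ : 0 < σ) (y θ : ℝ) : 0 < normalDensity σ y θ := by
  unfold normalDensity
  positivity

theorem normalDensity_le (σ y θ : ℝ) :
    normalDensity σ y θ ≤ 1 / Real.sqrt (2 * π * σ ^ 2) := by
  refine mul_le_of_le_one_right (by positivity) (Real.exp_le_one_iff.2 ?_)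
  rw [neg_div, neg_nonpos]
  positivity

theorem continuous_normalDensity (σ y : ℝ) : Continuous (normalDensity σ y) := by
  unfold normalDensity
  fun_prop

theorem hasDerivAt_normalDensity {σ : ℝ} (hσ : 0 < σ) (y θ : ℝ) :
    HasDerivAt (fun z => normalDensity σ z θ) ((θ - y) / σ ^ 2 * normalDensity σ y θ) y := by
  have h := (((((hasDerivAt_id y).sub_const θ).pow 2).neg.div_const (2 * σ ^ 2)).exp).const_mul
    (1 / Real.sqrt (2 * π * σ ^ 2))
  refine h.congr_deriv ?_
  simp only [normalDensity, id, Pi.neg_apply, Pi.pow_apply]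
  field_simp
  norm_num
  ring

theorem integrable_normalDensity {σ : ℝ} (hσ : 0 < σ) (μ : Measure ℝ) [IsFiniteMeasure μ]
    (y : ℝ) : Integrable (normalDensity σ y) μ :=
  .of_bound (continuous_normalDensity σ y).aestronglyMeasurable _ <| .of_forall fun θ => by
    rw [Real.norm_of_nonneg (normalDensity_pos hσ y θ).le]
    exact normalDensity_le σ y θ

theorem integral_normalDensity_pos {σ : ℝ} (hσ : 0 < σ) (μ : Measure ℝ) [IsFiniteMeasure μ]
    [NeZero μ] (y : ℝ) : 0 < ∫ θ, normalDensity σ y θ ∂μ := by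
  rw [integral_pos_iff_support_of_nonneg (fun θ => (normalDensity_pos hσ y θ).le)
    (integrable_normalDensity hσ μ y)]
  have h : Function.support (normalDensity σ y) = Set.univ :=
    Set.eq_univ_of_forall fun θ => (normalDensity_pos hσ y θ).ne'
  rw [h]
  exact NeZero.pos _

theorem integrable_mul_normalDensity {σ : ℝ} (hσ : 0 < σ) {μ : Measure ℝ}
    (hμ : Integrable (fun θ => |θ|) μ) (y : ℝ) :
    Integrable (fun θ => θ * normalDensity σ y θ) μ := by
  refine (hμ.mul_const (1 / Real.sqrt (2 * π * σ ^ 2))).mono'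
    (continuous_id.mul (continuous_normalDensity σ y)).aestronglyMeasurable
    (.of_forall fun θ => ?_)
  rw [norm_mul, Real.norm_eq_abs, Real.norm_of_nonneg (normalDensity_pos hσ y θ).le]
  gcongr
  exact normalDensity_le σ y θ

theorem hasDerivAt_integral_normalDensity {σ : ℝ} (hσ : 0 < σ) {μ : Measure ℝ}
    [IsFiniteMeasure μ] (hμ : Integrable (fun θ => |θ|) μ) (y : ℝ) :
    HasDerivAt (fun z => ∫ θ, normalDensity σ z θ ∂μ)
      (∫ θ, (θ - y) / σ ^ 2 * normalDensity σ y θ ∂μ) y := by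
  refine (hasDerivAt_integral_of_dominated_loc_of_deriv_le
    (F' := fun z θ => (θ - z) / σ ^ 2 * normalDensity σ z θ)
    (bound := fun θ => (|θ| + (|y| + 1)) / σ ^ 2 * (1 / Real.sqrt (2 * π * σ ^ 2)))
    (Metric.ball_mem_nhds y one_pos)
    (.of_forall fun z => (continuous_normalDensity σ z).aestronglyMeasurable)
    (integrable_normalDensity hσ μ y) ?_ (.of_forall fun θ z hz => ?_)
    (((hμ.add (integrable_const _)).div_const _).mul_const _)
    (.of_forall fun θ z _ => hasDerivAt_normalDensity hσ z θ)).2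
  · exact (((continuous_id.sub continuous_const).div_const _).mul
      (continuous_normalDensity σ y)).aestronglyMeasurable
  · rw [norm_mul, norm_div, Real.norm_of_nonneg (normalDensity_pos hσ z θ).le,
      Real.norm_of_nonneg (sq_nonneg σ), Real.norm_eq_abs]
    have hz' : |z| ≤ |y| + 1 := by
      have h₁ := abs_sub_abs_le_abs_sub z y
      have h₂ : |z - y| < 1 := hz
      linarith
    have h : |θ - z| ≤ |θ| + (|y| + 1) := (abs_sub θ z).trans (by gcongr)
    exact mul_le_mul (by gcongr) (normalDensity_le σ z θ) (normalDensity_pos hσ z θ).le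
      (by positivity)

/-- Tweedie's formula: in the Gaussian location model `y | θ ~ N(θ, σ²)` with prior
`μ` on `θ` having a finite first absolute moment, the marginal density
`m(y) = ∫ φ_σ(y − θ) dμ(θ)` is positive and differentiable, and the posterior mean
satisfies `E(θ | y) = y + σ²·(d/dy) log m(y)`. -/
theorem tweedie_formula (σ : ℝ) (hσ : 0 < σ) (μ : Measure ℝ) [IsProbabilityMeasure μ]
    (hmom : Integrable (fun θ => |θ|) μ) :
    ∀ y : ℝ,
      0 < (∫ θ, (1 / Real.sqrt (2 * π * σ ^ 2)) *
              Real.exp (-(y - θ) ^ 2 / (2 * σ ^ 2)) ∂μ) ∧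
      DifferentiableAt ℝ
        (fun z => ∫ θ, (1 / Real.sqrt (2 * π * σ ^ 2)) *
            Real.exp (-(z - θ) ^ 2 / (2 * σ ^ 2)) ∂μ) y ∧
      (∫ θ, θ * ((1 / Real.sqrt (2 * π * σ ^ 2)) *
          Real.exp (-(y - θ) ^ 2 / (2 * σ ^ 2))) ∂μ) /
        (∫ θ, (1 / Real.sqrt (2 * π * σ ^ 2)) *
          Real.exp (-(y - θ) ^ 2 / (2 * σ ^ 2)) ∂μ)
      = y + σ ^ 2 *
          deriv (fun z => Real.log (∫ θ, (1 / Real.sqrt (2 * π * σ ^ 2)) *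
            Real.exp (-(z - θ) ^ 2 / (2 * σ ^ 2)) ∂μ)) y := by
  intro y
  have hpos := integral_normalDensity_pos hσ μ y
  have hderiv := hasDerivAt_integral_normalDensity hσ hmom y
  refine ⟨hpos, hderiv.differentiableAt, ?_⟩
  change (∫ θ, θ * normalDensity σ y θ ∂μ) / (∫ θ, normalDensity σ y θ ∂μ)
    = y + σ ^ 2 * deriv (fun z => Real.log (∫ θ, normalDensity σ z θ ∂μ)) y
  have hscore : ∫ θ, (θ - y) / σ ^ 2 * normalDensity σ y θ ∂μ =
      ((∫ θ, θ * normalDensity σ y θ ∂μ) - y * ∫ θ, normalDensity σ y θ ∂μ) / σ ^ 2 := by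
    rw [← integral_const_mul, ← integral_sub (integrable_mul_normalDensity hσ hmom y)
      ((integrable_normalDensity hσ μ y).const_mul y), ← integral_div]
    congr with θ
    ring
  rw [(hderiv.log hpos.ne').deriv, hscore]
  field_simp
  ring
end
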